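/- Let γ > 3 and either λ < min{1, α(γ−1)/(γ−3)} or λ > max{1, α(γ−1)/(γ−3)}. There exist positive constants K₁, K₂ depending only on C₀, γ, K, λ and α such that the following holds: suppose the initial data (τ₀,u₀) ∈ C¹(ℝ) satisfy |u₀(x)| ≤ C₀ and C₀⁻¹ < τ₀(x) for all x, for some constant C₀ > 0, and let (τ,u) be a C¹ solution of the system on ℝ × [0,∞). If there exists a point x₀ such that u_x(x₀,0) + φ_x(x₀,0) < K₁ φ(x₀,0)^{−2/(γ−1)} − K₂ φ(x₀,0)^{−(γ+1)/(2(γ−1))}, or u_x(x₀,0) − φ_x(x₀,0) < K₁ φ(x₀,0)^{−2/(γ−1)} − K₂ φ(x₀,0)^{−(γ+1)/(2(γ−1))}, then ‖(τ_x,u_x)‖_{L∞} blows up in finite time. -/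

import Mathlib

open Real Set MeasureTheory

/-- Partial derivative in the space variable `x`. -/
noncomputable def pdx (f : ℝ → ℝ → ℝ) (x t : ℝ) : ℝ := deriv (fun y => f y t) x

/-- Partial derivative in the time variable `t`. -/
noncomputable def pdt (f : ℝ → ℝ → ℝ) (x t : ℝ) : ℝ := deriv (fun s => f x s) t

/-- `(τ, u)` is a `C¹` solution of the compressible Euler equations with
time-dependent damping `τ_t - u_x = 0`, `u_t + p_x = -(α/(1+t)^λ) u`,
`p = K τ^{-γ}`, on `ℝ × [0,∞)`. -/
def IsSol (K γ α lam : ℝ) (τ u : ℝ → ℝ → ℝ) : Prop :=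
  ContDiff ℝ 1 (fun p : ℝ × ℝ => τ p.1 p.2) ∧
  ContDiff ℝ 1 (fun p : ℝ × ℝ => u p.1 p.2) ∧
  (∀ x t, 0 ≤ t → 0 < τ x t) ∧
  (∀ x t, 0 ≤ t → pdt τ x t = pdx u x t) ∧
  (∀ x t, 0 ≤ t →
    pdt u x t + pdx (fun y s => K * τ y s ^ (-γ)) x t = -(α / (1 + t) ^ lam) * u x t)

/-- `φ = (2√(Kγ)/(γ-1)) τ^{-(γ-1)/2}`. -/
noncomputable def Phi (K γ : ℝ) (τ : ℝ → ℝ → ℝ) (x t : ℝ) : ℝ :=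
  (2 * Real.sqrt (K * γ) / (γ - 1)) * τ x t ^ (-(γ - 1) / 2)

/-- `K_τ = (2√(Kγ)/(γ-1))^{2/(γ-1)}`. -/
noncomputable def Ktau (K γ : ℝ) : ℝ := (2 * Real.sqrt (K * γ) / (γ - 1)) ^ (2 / (γ - 1))

/-- `K_c = √(Kγ) K_τ^{-(γ+1)/2}`. -/
noncomputable def Kc (K γ : ℝ) : ℝ := Real.sqrt (K * γ) * Ktau K γ ^ (-(γ + 1) / 2)

/-- Blow-up of `‖(τ_x, u_x)‖_{L^∞}` in finite time. -/
def BlowsUp (τ u : ℝ → ℝ → ℝ) : Prop :=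
  ∃ T > (0 : ℝ),
    ¬ BddAbove {r : ℝ | ∃ x t, 0 ≤ t ∧ t ≤ T ∧ r = |pdx τ x t| + |pdx u x t|}

/-- The Lagrangian sound speed `√(-p'(τ))` of the `γ`-law gas. -/
noncomputable def soundSpeed (K γ z : ℝ) : ℝ := √(K * γ) * z ^ (-(γ + 1) / 2)

/-- The function of the specific volume that enters the Riemann invariants `u ± φ`. -/
noncomputable def riemannPot (K γ z : ℝ) : ℝ :=
  (2 * √(K * γ) / (γ - 1)) * z ^ (-(γ - 1) / 2)

lemma soundSpeed_pos {K γ z : ℝ} (hK : 0 < K) (hγ : 0 < γ) (hz : 0 < z) :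
    0 < soundSpeed K γ z := by
  unfold soundSpeed; positivity

lemma riemannPot_pos {K γ z : ℝ} (hK : 0 < K) (hγ : 1 < γ) (hz : 0 < z) :
    0 < riemannPot K γ z := by
  have : 0 < γ - 1 := by linarith
  have : 0 < γ := by linarith
  unfold riemannPot; positivity

lemma riemannPot_le_iff {K γ z w : ℝ} (hK : 0 < K) (hγ : 1 < γ) (hz : 0 < z) (hw : 0 < w) :
    riemannPot K γ z ≤ riemannPot K γ w ↔ w ≤ z := by
  have h1 : 0 < γ - 1 := by linarith
  have h2 : 0 < γ := by linarith
  unfold riemannPot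
  rw [mul_le_mul_iff_right₀ (by positivity)]
  exact Real.rpow_le_rpow_iff_of_neg hz hw (by linarith)

lemma soundSpeed_le {K γ z w : ℝ} (hγ : -1 < γ) (hw : 0 < w) (hwz : w ≤ z) :
    soundSpeed K γ z ≤ soundSpeed K γ w := by
  unfold soundSpeed
  gcongr _ * ?_
  exact Real.rpow_le_rpow_of_nonpos hw hwz (by linarith)

lemma hasDerivAt_riemannPot {K γ z : ℝ} (hγ : γ ≠ 1) (hz : 0 < z) :
    HasDerivAt (riemannPot K γ) (-soundSpeed K γ z) z := by
  have h := (Real.hasDerivAt_rpow_const (p := -(γ - 1) / 2) (Or.inl hz.ne')).const_mul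
    (2 * √(K * γ) / (γ - 1))
  refine h.congr_deriv ?_
  have : γ - 1 ≠ 0 := sub_ne_zero.2 hγ
  rw [soundSpeed, show -(γ - 1) / 2 - 1 = -(γ + 1) / 2 by ring]
  field_simp

lemma hasDerivAt_soundSpeed {K γ z : ℝ} (hz : 0 < z) :
    HasDerivAt (soundSpeed K γ) (-((γ + 1) / (2 * z)) * soundSpeed K γ z) z := by
  have h := (Real.hasDerivAt_rpow_const (p := -(γ + 1) / 2) (Or.inl hz.ne')).const_mul
    (√(K * γ))
  refine h.congr_deriv ?_
  rw [soundSpeed, Real.rpow_sub_one hz.ne']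
  field_simp

lemma hasDerivAt_pressure {K γ z : ℝ} (hK : 0 ≤ K) (hγ : 0 ≤ γ) (hz : 0 < z) :
    HasDerivAt (fun y => K * y ^ (-γ)) (-soundSpeed K γ z ^ 2) z := by
  have h := (Real.hasDerivAt_rpow_const (p := -γ) (Or.inl hz.ne')).const_mul K
  refine h.congr_deriv ?_
  rw [soundSpeed, mul_pow, Real.sq_sqrt (by positivity), ← Real.rpow_natCast, ← Real.rpow_mul hz.le,
    show -(γ + 1) / 2 * ((2 : ℕ) : ℝ) = -γ - 1 by push_cast; ring]
  ring

section PartialDerivatives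

variable {f : ℝ → ℝ → ℝ}

lemma hasDerivAt_along (hf : ContDiff ℝ 1 (fun p : ℝ × ℝ => f p.1 p.2)) {X : ℝ → ℝ} {v t : ℝ}
    (hX : HasDerivAt X v t) :
    HasDerivAt (fun s => f (X s) s) (pdx f (X t) t * v + pdt f (X t) t) t := by
  have key : ∀ (Y Z : ℝ → ℝ) (v w s : ℝ), HasDerivAt Y v s → HasDerivAt Z w s →
      HasDerivAt (fun r => f (Y r) (Z r))
        (fderiv ℝ (fun p : ℝ × ℝ => f p.1 p.2) (Y s, Z s) (v, w)) s := by
    intro Y Z v w s hY hZ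
    exact ((hf.differentiable one_ne_zero (Y s, Z s)).hasFDerivAt).comp_hasDerivAt s
      (hY.prodMk hZ)
  have hx := (key id (fun _ => t) 1 0 (X t) (hasDerivAt_id _) (hasDerivAt_const _ _)).deriv
  have ht := (key (fun _ => X t) id 0 1 t (hasDerivAt_const _ _) (hasDerivAt_id _)).deriv
  refine (key X id v 1 t hX (hasDerivAt_id _)).congr_deriv ?_
  simp only [id] at hx ht ⊢
  rw [pdx, pdt, hx, ht, mul_comm, ← smul_eq_mul, ← map_smul, ← map_add]
  simp

lemma hasDerivAt_pdx (hf : ContDiff ℝ 1 (fun p : ℝ × ℝ => f p.1 p.2)) (x t : ℝ) :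
    HasDerivAt (fun y => f y t) (pdx f x t) x := by
  have : DifferentiableAt ℝ (fun y => f y t) x :=
    (hf.comp (contDiff_id.prodMk contDiff_const) : ContDiff ℝ 1 fun y : ℝ => f y t).differentiable
      one_ne_zero x
  exact this.hasDerivAt

lemma hasDerivAt_pdt (hf : ContDiff ℝ 1 (fun p : ℝ × ℝ => f p.1 p.2)) (x t : ℝ) :
    HasDerivAt (fun s => f x s) (pdt f x t) t := by
  simpa using hasDerivAt_along hf (hasDerivAt_const t x)

lemma continuous_pdx (hf : ContDiff ℝ 1 (fun p : ℝ × ℝ => f p.1 p.2)) :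
    Continuous (fun p : ℝ × ℝ => pdx f p.1 p.2) := by
  have h : (fun p : ℝ × ℝ => pdx f p.1 p.2) =
      fun p : ℝ × ℝ => fderiv ℝ (fun p : ℝ × ℝ => f p.1 p.2) p (1, 0) := by
    ext p
    have := ((hf.differentiable one_ne_zero (p.1, p.2)).hasFDerivAt).comp_hasDerivAt p.1
      ((hasDerivAt_id p.1).prodMk (hasDerivAt_const p.1 p.2))
    exact this.deriv
  rw [h]
  exact (hf.continuous_fderiv one_ne_zero).clm_apply continuous_const

end PartialDerivatives

lemma abs_sub_le_of_hasDerivAt {f f' : ℝ → ℝ} {L : ℝ} (h : ∀ x, HasDerivAt f (f' x) x)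
    (hL : ∀ x, |f' x| ≤ L) (x y : ℝ) : |f y - f x| ≤ L * |y - x| :=
  convex_univ.norm_image_sub_le_of_norm_hasDerivWithin_le
    (fun x _ => (h x).hasDerivWithinAt) (fun x _ => hL x) (mem_univ x) (mem_univ y)

/-- The space derivative of a solution of a scalar transport equation, evaluated along a
characteristic, is differentiable in time even if the solution is merely `C¹`. -/
lemma hasDerivAt_transport {S c f Sx cx fx St : ℝ → ℝ → ℝ} {X : ℝ → ℝ} {L : ℝ}
    (hSd : ∀ t ∈ Ioo (0 : ℝ) 1, ∀ (Y : ℝ → ℝ) (v : ℝ), HasDerivAt Y v t →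
      HasDerivAt (fun s => S (Y s) s) (Sx (Y t) t * v + St (Y t) t) t)
    (hSx : ∀ x, ∀ t ∈ Icc (0 : ℝ) 1, HasDerivAt (fun y => S y t) (Sx x t) x)
    (hcx : ∀ x, ∀ t ∈ Icc (0 : ℝ) 1, HasDerivAt (fun y => c y t) (cx x t) x)
    (hfx : ∀ x, ∀ t ∈ Icc (0 : ℝ) 1, HasDerivAt (fun y => f y t) (fx x t) x)
    (heq : ∀ x, ∀ t ∈ Ioo (0 : ℝ) 1, St x t + c x t * Sx x t = f x t)
    (bSx : ∀ x, ∀ t ∈ Icc (0 : ℝ) 1, |Sx x t| ≤ L)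
    (bcx : ∀ x, ∀ t ∈ Icc (0 : ℝ) 1, |cx x t| ≤ L)
    (bfx : ∀ x, ∀ t ∈ Icc (0 : ℝ) 1, |fx x t| ≤ L)
    (kS : ContinuousOn (fun p : ℝ × ℝ => S p.1 p.2) (univ ×ˢ Icc 0 1))
    (kc : ContinuousOn (fun p : ℝ × ℝ => c p.1 p.2) (univ ×ˢ Icc 0 1))
    (kf : ContinuousOn (fun p : ℝ × ℝ => f p.1 p.2) (univ ×ˢ Icc 0 1))
    (kSx : ContinuousOn (fun p : ℝ × ℝ => Sx p.1 p.2) (univ ×ˢ Icc 0 1))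
    (kcx : ContinuousOn (fun p : ℝ × ℝ => cx p.1 p.2) (univ ×ˢ Icc 0 1))
    (kfx : ContinuousOn (fun p : ℝ × ℝ => fx p.1 p.2) (univ ×ˢ Icc 0 1))
    (kX : ContinuousOn X (Icc 0 1)) (hX : ∀ t ∈ Ioo (0 : ℝ) 1, HasDerivAt X (c (X t) t) t)
    {t : ℝ} (ht : t ∈ Ioo (0 : ℝ) 1) :
    HasDerivAt (fun t => Sx (X t) t) (fx (X t) t - cx (X t) t * Sx (X t) t) t := by
  have hL : 0 ≤ L := (abs_nonneg _).trans (bSx 0 0 (by simp))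
  have along : ∀ {g : ℝ → ℝ → ℝ}, ContinuousOn (fun p : ℝ × ℝ => g p.1 p.2) (univ ×ˢ Icc 0 1) →
      ∀ h : ℝ, ContinuousOn (fun s => g (X s + h) s) (Icc 0 1) := by
    intro g hg h
    exact hg.comp ((kX.add continuousOn_const).prodMk continuousOn_id) fun s hs => ⟨mem_univ _, hs⟩
  have along₀ : ∀ {g : ℝ → ℝ → ℝ}, ContinuousOn (fun p : ℝ × ℝ => g p.1 p.2) (univ ×ˢ Icc 0 1) →
      ContinuousOn (fun s => g (X s) s) (Icc 0 1) := by
    intro g hg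
    simpa using along hg 0
  set R : ℝ → ℝ := fun s => fx (X s) s - cx (X s) s * Sx (X s) s with hR
  have kR : ContinuousOn R (Icc 0 1) := (along₀ kfx).sub ((along₀ kcx).mul (along₀ kSx))
  set Q : ℝ → ℝ → ℝ := fun h s => h⁻¹ * (f (X s + h) s - f (X s) s
    - (c (X s + h) s - c (X s) s) * Sx (X s + h) s) with hQ
  have kQ : ∀ h, ContinuousOn (Q h) (Icc 0 1) := fun h =>
    continuousOn_const.mul (((along kf h).sub (along₀ kf)).sub
      (((along kc h).sub (along₀ kc)).mul (along kSx h)))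
  have slope : ∀ {g g' : ℝ → ℝ → ℝ}, (∀ x, ∀ t ∈ Icc (0 : ℝ) 1,
      HasDerivAt (fun y => g y t) (g' x t) x) → ∀ s ∈ Icc (0 : ℝ) 1,
      Filter.Tendsto (fun h : ℝ => h⁻¹ * (g (X s + h) s - g (X s) s)) (nhdsWithin 0 {0}ᶜ)
        (nhds (g' (X s) s)) := by
    intro g g' hg s hs
    simpa using hasDerivAt_iff_tendsto_slope_zero.1 (hg (X s) s hs)
  have lip : ∀ {g g' : ℝ → ℝ → ℝ}, (∀ x, ∀ t ∈ Icc (0 : ℝ) 1,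
      HasDerivAt (fun y => g y t) (g' x t) x) → (∀ x, ∀ t ∈ Icc (0 : ℝ) 1, |g' x t| ≤ L) →
      ∀ s ∈ Icc (0 : ℝ) 1, ∀ h, h ≠ 0 → |h⁻¹ * (g (X s + h) s - g (X s) s)| ≤ L := by
    intro g g' hg hb s hs h hh
    have := abs_sub_le_of_hasDerivAt (fun x => hg x s hs) (fun x => hb x s hs) (X s) (X s + h)
    rw [add_sub_cancel_left] at this
    rw [abs_mul, abs_inv, inv_mul_le_iff₀ (abs_pos.2 hh), mul_comm]
    exact this
  have sub01 : ∀ {r : ℝ}, r ∈ Icc (0 : ℝ) 1 → Icc 0 r ⊆ Icc (0 : ℝ) 1 := fun hr =>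
    Icc_subset_Icc_right hr.2
  have int_eq : ∀ r ∈ Icc (0 : ℝ) 1, Sx (X r) r = Sx (X 0) 0 + ∫ s in (0 : ℝ)..r, R s := by
    intro r hr
    have ftc : ∀ h, ∫ s in (0 : ℝ)..r, Q h s =
        h⁻¹ * (S (X r + h) r - S (X r) r) - h⁻¹ * (S (X 0 + h) 0 - S (X 0) 0) := by
      intro h
      refine intervalIntegral.integral_eq_sub_of_hasDerivAt_of_le
        (f := fun s => h⁻¹ * (S (X s + h) s - S (X s) s)) hr.1
        ((continuousOn_const.mul ((along kS h).sub (along₀ kS))).mono (sub01 hr)) ?_ ?_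
      · intro s hs
        have hs' : s ∈ Ioo (0 : ℝ) 1 := ⟨hs.1, hs.2.trans_le hr.2⟩
        refine (((hSd s hs' (fun s => X s + h) _ ((hX s hs').add_const h)).sub
          (hSd s hs' X _ (hX s hs'))).const_mul h⁻¹).congr_deriv ?_
        simp only [hQ, ← heq _ s hs']
        ring
      · exact ((kQ h).mono (sub01 hr)).intervalIntegrable_of_Icc hr.1
    have lim := intervalIntegral.tendsto_integral_filter_of_dominated_convergence
      (μ := volume) (a := 0) (b := r) (F := Q) (f := R) (l := nhdsWithin 0 {0}ᶜ)
      (fun _ => L + L * L) ?_ ?_ (by simp) ?_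
    · have lim' := (slope hSx r hr).sub (slope hSx 0 (by simp))
      simp only [ftc] at lim
      have := tendsto_nhds_unique lim lim'
      linarith
    · refine Filter.Eventually.of_forall fun h => ?_
      rw [uIoc_of_le hr.1]
      exact ((kQ h).mono (Ioc_subset_Icc_self.trans (sub01 hr))).aestronglyMeasurable
        measurableSet_Ioc
    · filter_upwards [self_mem_nhdsWithin] with h hh
      refine Filter.Eventually.of_forall fun s hs => ?_
      rw [uIoc_of_le hr.1] at hs
      have hs' := sub01 hr (Ioc_subset_Icc_self hs)
      have e : Q h s = h⁻¹ * (f (X s + h) s - f (X s) s)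
          - h⁻¹ * (c (X s + h) s - c (X s) s) * Sx (X s + h) s := by
        simp only [hQ]; ring
      rw [e]
      refine (norm_sub_le _ _).trans (add_le_add (lip hfx bfx s hs' h hh) ?_)
      rw [norm_mul]
      exact mul_le_mul (lip hcx bcx s hs' h hh) (bSx _ s hs') (norm_nonneg _) hL
    · refine Filter.Eventually.of_forall fun s hs => ?_
      rw [uIoc_of_le hr.1] at hs
      have hs' := sub01 hr (Ioc_subset_Icc_self hs)
      have k : Filter.Tendsto (fun h : ℝ => Sx (X s + h) s) (nhdsWithin 0 {0}ᶜ)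
          (nhds (Sx (X s) s)) := by
        have k1 : Continuous fun h : ℝ => Sx (X s + h) s :=
          kSx.comp_continuous (f := fun h : ℝ => (X s + h, s)) (by fun_prop)
            fun h => ⟨mem_univ _, hs'⟩
        simpa using (k1.tendsto 0).mono_left nhdsWithin_le_nhds
      refine ((slope hfx s hs').sub ((slope hcx s hs').mul k)).congr fun h => ?_
      simp only [hQ]; ring
  have hd : HasDerivAt (fun r => Sx (X 0) 0 + ∫ s in (0 : ℝ)..r, R s) (R t) t := by
    refine (intervalIntegral.integral_hasDerivAt_right ?_ ?_ ?_).const_add _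
    · exact (kR.mono (sub01 ⟨ht.1.le, ht.2.le⟩)).intervalIntegrable_of_Icc ht.1.le
    · exact ContinuousOn.stronglyMeasurableAtFilter isOpen_Ioo (kR.mono Ioo_subset_Icc_self) t ht
    · exact kR.continuousAt (Icc_mem_nhds ht.1 ht.2)
  refine hd.congr_of_eventuallyEq ?_
  filter_upwards [Icc_mem_nhds ht.1 ht.2] with r hr using int_eq r hr

/-- A `C¹` solution on `ℝ × [0,∞)` of the Euler equations with damping coefficient `a`, with the
pressure gradient expanded. -/
structure IsDampedFlow (K γ : ℝ) (a : ℝ → ℝ) (τ u : ℝ → ℝ → ℝ) : Prop where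
  contDiff_vol : ContDiff ℝ 1 (fun p : ℝ × ℝ => τ p.1 p.2)
  contDiff_vel : ContDiff ℝ 1 (fun p : ℝ × ℝ => u p.1 p.2)
  pos : ∀ x t, 0 ≤ t → 0 < τ x t
  mass : ∀ x t, 0 ≤ t → pdt τ x t = pdx u x t
  momentum : ∀ x t, 0 ≤ t →
    pdt u x t = soundSpeed K γ (τ x t) ^ 2 * pdx τ x t - a t * u x t

lemma IsSol.isDampedFlow {K γ α lam : ℝ} {τ u : ℝ → ℝ → ℝ} (hK : 0 ≤ K) (hγ : 0 ≤ γ)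
    (h : IsSol K γ α lam τ u) : IsDampedFlow K γ (fun t => α / (1 + t) ^ lam) τ u := by
  obtain ⟨h1, h2, h3, h4, h5⟩ := h
  refine ⟨h1, h2, h3, h4, fun x t ht => ?_⟩
  have hp : pdx (fun y s => K * τ y s ^ (-γ)) x t =
      -soundSpeed K γ (τ x t) ^ 2 * pdx τ x t :=
    (HasDerivAt.comp (h₂ := fun y => K * y ^ (-γ)) x
      (hasDerivAt_pressure hK hγ (h3 x t ht)) (hasDerivAt_pdx h1 x t)).deriv
  have := h5 x t ht
  rw [hp] at this
  linear_combination this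

lemma hasDerivAt_riemannPot_comp {K γ f' x : ℝ} {f : ℝ → ℝ} (hγ : γ ≠ 1)
    (hf : HasDerivAt f f' x) (hpos : 0 < f x) :
    HasDerivAt (fun y => riemannPot K γ (f y)) (-soundSpeed K γ (f x) * f') x :=
  HasDerivAt.comp (h₂ := riemannPot K γ) x (hasDerivAt_riemannPot hγ hpos) hf

lemma hasDerivAt_soundSpeed_comp {K γ f' x : ℝ} {f : ℝ → ℝ}
    (hf : HasDerivAt f f' x) (hpos : 0 < f x) :
    HasDerivAt (fun y => soundSpeed K γ (f y))
      (-((γ + 1) / (2 * f x)) * soundSpeed K γ (f x) * f') x :=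
  HasDerivAt.comp (h₂ := soundSpeed K γ) x (hasDerivAt_soundSpeed hpos) hf

lemma pdx_Phi {K γ : ℝ} {τ : ℝ → ℝ → ℝ} (hγ : γ ≠ 1)
    (h : ContDiff ℝ 1 (fun p : ℝ × ℝ => τ p.1 p.2)) {x t : ℝ} (hpos : 0 < τ x t) :
    pdx (Phi K γ τ) x t = -soundSpeed K γ (τ x t) * pdx τ x t :=
  (hasDerivAt_riemannPot_comp hγ (hasDerivAt_pdx h x t) hpos).deriv

lemma deriv_nonpos_of_le_left {g : ℝ → ℝ} {g' t₀ t : ℝ} (h : HasDerivAt g g' t) (ht : t₀ < t)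
    (hg : ∀ s ∈ Ioo t₀ t, g t ≤ g s) : g' ≤ 0 := by
  have h1 : Filter.Tendsto (slope g t) (nhdsWithin t (Iio t)) (nhds g') :=
    (hasDerivAt_iff_tendsto_slope.1 h).mono_left (nhdsWithin_mono _ fun s hs => ne_of_lt hs)
  refine le_of_tendsto h1 ?_
  filter_upwards [Ioo_mem_nhdsLT ht] with s hs
  rw [slope_def_field]
  exact div_nonpos_of_nonneg_of_nonpos (sub_nonneg.2 (hg s hs)) (sub_nonpos.2 hs.2.le)

namespace IsDampedFlow

variable {K γ : ℝ} {a : ℝ → ℝ} {τ u : ℝ → ℝ → ℝ}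

lemma continuousOn_riemannPot (h : IsDampedFlow K γ a τ u) (hγ : γ ≠ 1) (s : Set ℝ) {T : ℝ} :
    ContinuousOn (fun p : ℝ × ℝ => riemannPot K γ (τ p.1 p.2)) (s ×ˢ Icc 0 T) := fun p hp =>
  ContinuousAt.continuousWithinAt
    (((hasDerivAt_riemannPot hγ (h.pos p.1 p.2 hp.2.1)).continuousAt).comp
      (f := fun p : ℝ × ℝ => τ p.1 p.2) h.contDiff_vol.continuous.continuousAt)

lemma continuousOn_soundSpeed (h : IsDampedFlow K γ a τ u) (s : Set ℝ) {T : ℝ} :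
    ContinuousOn (fun p : ℝ × ℝ => soundSpeed K γ (τ p.1 p.2)) (s ×ˢ Icc 0 T) := fun p hp =>
  ContinuousAt.continuousWithinAt
    (((hasDerivAt_soundSpeed (h.pos p.1 p.2 hp.2.1)).continuousAt).comp
      (f := fun p : ℝ × ℝ => τ p.1 p.2) h.contDiff_vol.continuous.continuousAt)

/-- The Riemann invariants `u ± φ` do not increase in modulus: penalized version. -/
lemma abs_add_riemannPot_le_penalty (h : IsDampedFlow K γ a τ u) (hK : 0 < K) (hγ : 1 < γ)
    {T M m M₀ : ℝ} (ha : ∀ t ∈ Icc 0 T, 0 ≤ a t) (hm : 0 < m)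
    (hτ : ∀ x, ∀ t ∈ Icc 0 T, m ≤ τ x t) (hM : ∀ x, ∀ t ∈ Icc 0 T, |pdx u x t| ≤ M)
    (h0 : ∀ x, |u x 0| + riemannPot K γ (τ x 0) ≤ M₀) {ε : ℝ} (hε : 0 < ε) (x : ℝ) {t : ℝ}
    (ht : t ∈ Icc 0 T) :
    |u x t| + riemannPot K γ (τ x t) ≤
      M₀ + ε * (1 + x ^ 2) * exp ((soundSpeed K γ m + 1) * t) := by
  set L := soundSpeed K γ m + 1 with hL
  have hcm : 0 < soundSpeed K γ m := soundSpeed_pos hK (by linarith) hm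
  by_contra! hlt
  set V : ℝ → ℝ → ℝ := fun x t => M₀ + ε * (1 + x ^ 2) * exp (L * t) with hV
  set G : ℝ × ℝ → ℝ := fun p => V p.1 p.2 - (|u p.1 p.2| + riemannPot K γ (τ p.1 p.2)) with hG
  have kG : ContinuousOn G (univ ×ˢ Icc 0 T) := by
    refine ContinuousOn.sub ?_ (ContinuousOn.add ?_ (h.continuousOn_riemannPot hγ.ne' _))
    · simp only [hV]; fun_prop
    · exact h.contDiff_vel.continuous.abs.continuousOn
  have hM₀ : 0 ≤ M₀ := (add_nonneg (abs_nonneg _)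
    (riemannPot_pos hK hγ (h.pos 0 0 le_rfl)).le).trans (h0 0)
  have hMnn : 0 ≤ M := (abs_nonneg _).trans (hM x t ht)
  obtain ⟨U, hU⟩ : ∃ U, ∀ t ∈ Icc 0 T, |u 0 t| ≤ U := by
    obtain ⟨U, hU⟩ := isCompact_Icc.exists_bound_of_continuousOn (s := Icc 0 T)
      (f := fun t => u 0 t)
      ((h.contDiff_vel.continuous.comp (by fun_prop : Continuous fun t : ℝ => ((0 : ℝ), t)))).continuousOn
    exact ⟨U, hU⟩
  set B := U + riemannPot K γ m with hB
  have hBnn : 0 ≤ B := add_nonneg ((abs_nonneg _).trans (hU t ht)) (riemannPot_pos hK hγ hm).le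
  set R := (B + M) / ε + 1 with hR
  have grow : ∀ y, ∀ s ∈ Icc 0 T, G (y, s) ≤ 0 → |y| ≤ R := by
    intro y s hs hGy
    by_contra! hy
    have hR1 : 1 ≤ R := by rw [hR]; linarith [div_nonneg (add_nonneg hBnn hMnn) hε.le]
    have h1 := abs_sub_le_of_hasDerivAt (fun z => hasDerivAt_pdx h.contDiff_vel z s)
      (fun z => hM z s hs) 0 y
    rw [sub_zero] at h1
    have h2 : |u y s| ≤ U + M * |y| := by
      have := abs_sub_abs_le_abs_sub (u y s) (u 0 s)
      linarith [hU s hs]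
    have h3 : riemannPot K γ (τ y s) ≤ riemannPot K γ m :=
      (riemannPot_le_iff hK hγ (h.pos y s hs.1) hm).2 (hτ y s hs)
    have h4 : ε * (1 + y ^ 2) * 1 ≤ ε * (1 + y ^ 2) * exp (L * s) := by
      gcongr
      exact one_le_exp (mul_nonneg (by linarith) hs.1)
    have h5 : B + M < ε * |y| := by
      have : (B + M) / ε < |y| := by linarith
      rwa [div_lt_iff₀' hε] at this
    have h6 : G (y, s) = M₀ + ε * (1 + y ^ 2) * exp (L * s) -
      (|u y s| + riemannPot K γ (τ y s)) := rfl
    have h7 : (B + M) * |y| ≤ ε * |y| * |y| := by gcongr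
    have h8 : B ≤ B * |y| := le_mul_of_one_le_right hBnn (by linarith)
    have h9 : |y| * |y| = y ^ 2 := by rw [← sq, sq_abs]
    nlinarith
  have hclosed : IsClosed ((univ ×ˢ Icc 0 T) ∩ G ⁻¹' Iic 0) :=
    kG.preimage_isClosed_of_isClosed (isClosed_univ.prod isClosed_Icc) isClosed_Iic
  have hcompact : IsCompact ((univ ×ˢ Icc 0 T) ∩ G ⁻¹' Iic 0) := by
    refine (isCompact_Icc.prod isCompact_Icc : IsCompact (Icc (-R) R ×ˢ Icc 0 T)).of_isClosed_subset
      hclosed ?_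
    rintro ⟨y, s⟩ ⟨⟨-, hs⟩, hy⟩
    exact ⟨abs_le.1 (grow y s hs hy), hs⟩
  obtain ⟨⟨x₁, t₁⟩, ⟨⟨-, ht₁⟩, hG₁⟩, hmin⟩ := hcompact.exists_isMinOn
    ⟨(x, t), ⟨mem_univ _, ht⟩, by simp only [hG, hV, mem_preimage, mem_Iic]; linarith⟩
    (continuous_snd.continuousOn)
  change t₁ ∈ Icc 0 T at ht₁
  change G (x₁, t₁) ≤ 0 at hG₁
  have hmin' : ∀ y s, s ∈ Icc 0 T → G (y, s) ≤ 0 → t₁ ≤ s := fun y s hs hy =>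
    hmin (⟨⟨mem_univ _, hs⟩, hy⟩ : (y, s) ∈ (univ ×ˢ Icc 0 T) ∩ G ⁻¹' Iic 0)
  have hG0 : ∀ y, 0 < G (y, 0) := by
    intro y
    simp only [hG, hV, mul_zero, exp_zero]
    have : 0 < ε * (1 + y ^ 2) := by positivity
    linarith [h0 y]
  have ht₁0 : 0 < t₁ := by
    rcases ht₁.1.eq_or_lt with h' | h'
    · exact absurd (h' ▸ hG₁) (not_le.2 (hG0 x₁))
    · exact h'
  have hpos : ∀ y, ∀ s ∈ Icc 0 t₁, 0 ≤ G (y, s) := by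
    intro y s hs
    by_contra! hneg
    have k : ContinuousOn (fun r => G (y, r)) (Icc 0 s) :=
      kG.comp (by fun_prop) fun r hr => ⟨mem_univ _, hr.1, (hr.2.trans hs.2).trans ht₁.2⟩
    obtain ⟨r, hr, hr0⟩ := intermediate_value_Icc' hs.1 k ⟨hneg.le, (hG0 y).le⟩
    have hr0 : G (y, r) = 0 := hr0
    have hrs : r < s := lt_of_le_of_ne hr.2 (by rintro rfl; linarith)
    have := hmin' y r ⟨hr.1, (hr.2.trans hs.2).trans ht₁.2⟩ hr0.le
    linarith [hs.2]
  have hG₁' : G (x₁, t₁) = 0 := le_antisymm hG₁ (hpos x₁ t₁ ⟨ht₁0.le, le_rfl⟩)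
  obtain ⟨σ, hσ2, hσ, hσle⟩ : ∃ σ : ℝ, σ * σ = 1 ∧ σ * u x₁ t₁ = |u x₁ t₁| ∧
      ∀ w : ℝ, σ * w ≤ |w| := by
    rcases le_total 0 (u x₁ t₁) with h' | h'
    · exact ⟨1, by norm_num, by rw [abs_of_nonneg h', one_mul], fun w => by
        rw [one_mul]; exact le_abs_self w⟩
    · exact ⟨-1, by norm_num, by rw [abs_of_nonpos h']; ring, fun w => by
        rw [neg_one_mul]; exact neg_le_abs w⟩
  have hτ₁ := h.pos x₁ t₁ ht₁0.le
  have dx : HasDerivAt (fun y => V y t₁ - (σ * u y t₁ + riemannPot K γ (τ y t₁)))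
      (ε * (2 * x₁) * exp (L * t₁) -
        (σ * pdx u x₁ t₁ + -soundSpeed K γ (τ x₁ t₁) * pdx τ x₁ t₁)) x₁ := by
    refine HasDerivAt.sub ?_ (((hasDerivAt_pdx h.contDiff_vel x₁ t₁).const_mul σ).add
      (hasDerivAt_riemannPot_comp hγ.ne' (hasDerivAt_pdx h.contDiff_vol x₁ t₁) hτ₁))
    have := ((((hasDerivAt_pow 2 x₁).const_add 1).const_mul ε).mul_const
      (exp (L * t₁))).const_add M₀
    exact this.congr_deriv (by simp)
  have dt : HasDerivAt (fun s => V x₁ s - (σ * u x₁ s + riemannPot K γ (τ x₁ s)))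
      (ε * (1 + x₁ ^ 2) * (exp (L * t₁) * L) -
        (σ * pdt u x₁ t₁ + -soundSpeed K γ (τ x₁ t₁) * pdt τ x₁ t₁)) t₁ := by
    refine HasDerivAt.sub ?_ (((hasDerivAt_pdt h.contDiff_vel x₁ t₁).const_mul σ).add
      (hasDerivAt_riemannPot_comp hγ.ne' (hasDerivAt_pdt h.contDiff_vol x₁ t₁) hτ₁))
    have := ((((hasDerivAt_id t₁).const_mul L).exp).const_mul (ε * (1 + x₁ ^ 2))).const_add M₀
    exact this.congr_deriv (by simp)
  have hval : V x₁ t₁ - (σ * u x₁ t₁ + riemannPot K γ (τ x₁ t₁)) = 0 := by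
    rw [hσ]; exact hG₁'
  have hge : ∀ y, ∀ s ∈ Icc 0 t₁, 0 ≤ V y s - (σ * u y s + riemannPot K γ (τ y s)) := by
    intro y s hs
    have h1 : 0 ≤ V y s - (|u y s| + riemannPot K γ (τ y s)) := hpos y s hs
    linarith [hσle (u y s)]
  have ex := IsLocalMin.hasDerivAt_eq_zero (Filter.Eventually.of_forall fun y => by
    rw [hval]; exact hge y t₁ ⟨ht₁0.le, le_rfl⟩) dx
  have et := deriv_nonpos_of_le_left dt ht₁0 fun s hs => by
    rw [hval]; exact hge x₁ s ⟨hs.1.le, hs.2.le⟩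
  rw [h.mass x₁ t₁ ht₁0.le, h.momentum x₁ t₁ ht₁0.le] at et
  set c := soundSpeed K γ (τ x₁ t₁) with hc
  have hc0 : 0 < c := soundSpeed_pos hK (by linarith) hτ₁
  have hcle : c ≤ soundSpeed K γ m := soundSpeed_le (by linarith) hm (hτ x₁ t₁ ht₁)
  set E := exp (L * t₁) with hE
  have hE0 : 0 < E := exp_pos _
  have hau : 0 ≤ a t₁ * |u x₁ t₁| := mul_nonneg (ha t₁ ht₁) (abs_nonneg _)
  have key : ε * (1 + x₁ ^ 2) * (E * L) ≤ -(c * (σ * (ε * (2 * x₁) * E))) := by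
    rw [← hσ] at hau
    have e : σ * (c ^ 2 * pdx τ x₁ t₁ - a t₁ * u x₁ t₁) + -c * pdx u x₁ t₁ =
        -(c * (σ * (σ * pdx u x₁ t₁ + -c * pdx τ x₁ t₁))) - a t₁ * (σ * u x₁ t₁) := by
      linear_combination (c * pdx u x₁ t₁) * hσ2
    rw [e, ← sub_eq_zero.1 ex] at et
    linarith
  have hx2 : -(σ * (2 * x₁)) ≤ 1 + x₁ ^ 2 := by nlinarith [sq_nonneg (σ + x₁)]
  have hεE : 0 < ε * E := mul_pos hε hE0
  have : c * -(σ * (2 * x₁)) ≤ c * (1 + x₁ ^ 2) := by gcongr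
  have h1 : c * (1 + x₁ ^ 2) ≤ soundSpeed K γ m * (1 + x₁ ^ 2) := by gcongr
  have h2 : ε * E * ((1 + x₁ ^ 2) * L) ≤ ε * E * (soundSpeed K γ m * (1 + x₁ ^ 2)) := by
    calc _ ≤ ε * E * (c * -(σ * (2 * x₁))) := by linarith
      _ ≤ _ := mul_le_mul_of_nonneg_left (this.trans h1) hεE.le
  have h3 := le_of_mul_le_mul_left h2 hεE
  rw [hL] at h3
  nlinarith [sq_nonneg x₁]

/-- The Riemann invariants `u ± φ` do not increase in modulus. -/
lemma abs_add_riemannPot_le (h : IsDampedFlow K γ a τ u) (hK : 0 < K) (hγ : 1 < γ)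
    {T M m M₀ : ℝ} (ha : ∀ t ∈ Icc 0 T, 0 ≤ a t) (hm : 0 < m)
    (hτ : ∀ x, ∀ t ∈ Icc 0 T, m ≤ τ x t) (hM : ∀ x, ∀ t ∈ Icc 0 T, |pdx u x t| ≤ M)
    (h0 : ∀ x, |u x 0| + riemannPot K γ (τ x 0) ≤ M₀) (x : ℝ) {t : ℝ} (ht : t ∈ Icc 0 T) :
    |u x t| + riemannPot K γ (τ x t) ≤ M₀ := by
  refine le_of_forall_pos_le_add fun δ hδ => ?_
  set P := (1 + x ^ 2) * exp ((soundSpeed K γ m + 1) * t) with hP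
  have hP0 : 0 < P := by positivity
  have := h.abs_add_riemannPot_le_penalty hK hγ ha hm hτ hM h0 (div_pos hδ hP0) x ht
  rwa [mul_assoc, ← hP, div_mul_cancel₀ _ hP0.ne'] at this

/-- A pointwise lower bound for the specific volume that does not depend on the size of the
derivatives of the flow. -/
lemma le_vol (h : IsDampedFlow K γ a τ u) (hK : 0 < K) (hγ : 1 < γ) {T M m : ℝ}
    (ha : ∀ t ∈ Icc 0 T, 0 ≤ a t) (hm : 0 < m) (hM : ∀ x, ∀ t ∈ Icc 0 T, |pdx u x t| ≤ M)
    (h0 : ∀ x, |u x 0| + riemannPot K γ (τ x 0) ≤ riemannPot K γ m) (x : ℝ) {t : ℝ}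
    (ht : t ∈ Icc 0 T) : m ≤ τ x t := by
  have hMnn : 0 ≤ M := (abs_nonneg _).trans (hM x t ht)
  set δ := m / (2 * (M + 1)) with hδ
  have hδ0 : 0 < δ := by positivity
  have hMδ : M * δ ≤ m / 2 := by
    rw [hδ, mul_div_assoc', div_le_iff₀ (by positivity)]
    nlinarith
  have step : ∀ n : ℕ, ∀ x, ∀ t ∈ Icc 0 (min (n * δ) T), m ≤ τ x t := by
    intro n
    induction n with
    | zero =>
      intro x t ht
      have ht' : t = 0 := le_antisymm (ht.2.trans (by simp)) ht.1
      rw [ht', ← riemannPot_le_iff hK hγ (h.pos x 0 le_rfl) hm]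
      linarith [h0 x, abs_nonneg (u x 0)]
    | succ n ih =>
      have sub : ∀ t ∈ Icc 0 (min ((n + 1 : ℕ) * δ) T), t ∈ Icc 0 T := fun t ht =>
        ⟨ht.1, ht.2.trans (min_le_right _ _)⟩
      have low : ∀ x, ∀ t ∈ Icc 0 (min ((n + 1 : ℕ) * δ) T), m / 2 ≤ τ x t := by
        intro x t ht
        rcases le_total t (n * δ) with h' | h'
        · linarith [ih x t ⟨ht.1, le_min h' (sub t ht).2⟩]
        · have hnδ : 0 ≤ n * δ := by positivity
          have h1 := ih x (n * δ) ⟨hnδ, le_min le_rfl (h'.trans (sub t ht).2)⟩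
          have h2 := (convex_Icc 0 T).norm_image_sub_le_of_norm_hasDerivWithin_le
            (f := fun s => τ x s) (f' := fun s => pdt τ x s) (C := M)
            (fun s _ => (hasDerivAt_pdt h.contDiff_vol x s).hasDerivWithinAt)
            (fun s hs => by rw [h.mass x s hs.1]; exact hM x s hs)
            ⟨hnδ, h'.trans (sub t ht).2⟩ (sub t ht)
          rw [Real.norm_eq_abs, Real.norm_eq_abs, abs_of_nonneg (sub_nonneg.2 h')] at h2
          have h3 : t - n * δ ≤ δ := by
            have := ht.2.trans (min_le_left _ _)
            push_cast at this
            linarith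
          have h4 : M * (t - n * δ) ≤ M * δ := by gcongr
          linarith [neg_le_of_abs_le h2]
      intro x t ht
      rw [← riemannPot_le_iff hK hγ (h.pos x t ht.1) hm]
      have := h.abs_add_riemannPot_le hK hγ (fun t ht => ha t (sub t ht)) (half_pos hm) low
        (fun x t ht => hM x t (sub t ht)) h0 x ht
      linarith [abs_nonneg (u x t)]
  obtain ⟨n, hn⟩ := exists_nat_ge (T / δ)
  exact step n x t ⟨ht.1, le_min (ht.2.trans ((div_le_iff₀ hδ0).1 hn)) ht.2⟩

end IsDampedFlow

lemma false_of_riccati {q q' : ℝ → ℝ} {β N : ℝ} (hN : 0 < N) (hβN : 1 ≤ β * N)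
    (kq : ContinuousOn q (Icc 0 1)) (hq : ∀ t ∈ Ioo (0 : ℝ) 1, HasDerivAt q (q' t) t)
    (hle : ∀ t ∈ Ioo (0 : ℝ) 1, q t ≤ -N → q' t ≤ -β * q t ^ 2) (h0 : q 0 < -N) : False := by
  have hβ : 0 < β := pos_of_mul_pos_left (by linarith) hN.le
  have hlt : ∀ t ∈ Icc (0 : ℝ) 1, q t < -N := by
    by_contra! hex
    obtain ⟨t, ht, hqt⟩ := hex
    have hcl : IsClosed (Icc (0 : ℝ) 1 ∩ q ⁻¹' Ici (-N)) :=
      kq.preimage_isClosed_of_isClosed isClosed_Icc isClosed_Ici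
    obtain ⟨t₁, ⟨ht₁, hq₁⟩, hmin⟩ :=
      (isCompact_Icc.of_isClosed_subset hcl inter_subset_left).exists_isMinOn ⟨t, ht, hqt⟩
        continuousOn_id
    have hq₁ : -N ≤ q t₁ := hq₁
    have hanti : AntitoneOn q (Icc 0 t₁) := by
      have hsub : ∀ s ∈ interior (Icc 0 t₁), s ∈ Ioo (0 : ℝ) 1 ∧ s < t₁ := fun s hs => by
        rw [interior_Icc] at hs
        exact ⟨⟨hs.1, hs.2.trans_le ht₁.2⟩, hs.2⟩
      refine antitoneOn_of_deriv_nonpos (convex_Icc _ _) (kq.mono (Icc_subset_Icc_right ht₁.2))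
        (fun s hs => (hq s (hsub s hs).1).differentiableAt.differentiableWithinAt) fun s hs => ?_
      obtain ⟨hs1, hs2⟩ := hsub s hs
      have hqs : q s ≤ -N := by
        by_contra! hc
        have h' : t₁ ≤ s := hmin (⟨⟨hs1.1.le, hs1.2.le⟩, hc.le⟩ : s ∈ Icc (0 : ℝ) 1 ∩ q ⁻¹' Ici (-N))
        linarith
      rw [(hq s hs1).deriv]
      have : 0 ≤ β * q s ^ 2 := by positivity
      linarith [hle s hs1 hqs]
    have := hanti ⟨le_rfl, ht₁.1⟩ ⟨ht₁.1, le_rfl⟩ ht₁.1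
    linarith
  have hneg : ∀ t ∈ Icc (0 : ℝ) 1, q t < 0 := fun t ht => (hlt t ht).trans (by linarith)
  have hmono : MonotoneOn (fun t => (q t)⁻¹ - β * t) (Icc 0 1) := by
    have hd : ∀ t ∈ Ioo (0 : ℝ) 1,
        HasDerivAt (fun t => (q t)⁻¹ - β * t) (-q' t / q t ^ 2 - β * 1) t := fun t ht =>
      ((hq t ht).inv (hneg t (Ioo_subset_Icc_self ht)).ne).sub ((hasDerivAt_id t).const_mul β)
    refine monotoneOn_of_deriv_nonneg (convex_Icc _ _)
      ((kq.inv₀ fun t ht => (hneg t ht).ne).sub (by fun_prop)) ?_ ?_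
    · rw [interior_Icc]
      exact fun t ht => (hd t ht).differentiableAt.differentiableWithinAt
    · rw [interior_Icc]
      intro t ht
      have ht' := Ioo_subset_Icc_self ht
      have hpos : 0 < q t ^ 2 := sq_pos_of_neg (hneg t ht')
      rw [(hd t ht).deriv, mul_one, sub_nonneg, le_div_iff₀ hpos]
      linarith [hle t ht (hlt t ht').le]
  have h1 := hmono ⟨le_rfl, zero_le_one⟩ ⟨zero_le_one, le_rfl⟩ zero_le_one
  simp only [mul_zero, sub_zero, mul_one] at h1
  have h2 : (q 1)⁻¹ < 0 := inv_lt_zero.2 (hneg 1 (by simp))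
  have h3 : -N⁻¹ < (q 0)⁻¹ := by
    rw [← inv_neg]
    exact (inv_lt_inv_of_neg (by linarith) (hneg 0 (by simp))).2 h0
  have h4 : N⁻¹ ≤ β := (inv_le_iff_one_le_mul₀ hN).2 hβN
  linarith

lemma pdx_comp_neg (f : ℝ → ℝ → ℝ) (x t : ℝ) :
    pdx (fun x t => f (-x) t) x t = -pdx f (-x) t :=
  deriv_comp_neg (fun y => f y t) x

lemma pdx_neg_comp_neg (f : ℝ → ℝ → ℝ) (x t : ℝ) :
    pdx (fun x t => -f (-x) t) x t = pdx f (-x) t := by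
  have := pdx_comp_neg f x t
  simp only [pdx] at this ⊢
  rw [deriv.fun_neg, this, neg_neg]

namespace IsDampedFlow

variable {K γ : ℝ} {a : ℝ → ℝ} {τ u : ℝ → ℝ → ℝ}

lemma hasDerivAt_soundSpeed_pdx (h : IsDampedFlow K γ a τ u) (x : ℝ) {t : ℝ} (ht : 0 ≤ t) :
    HasDerivAt (fun y => soundSpeed K γ (τ y t))
      (-((γ + 1) / (2 * τ x t)) * soundSpeed K γ (τ x t) * pdx τ x t) x :=
  hasDerivAt_soundSpeed_comp (hasDerivAt_pdx h.contDiff_vol x t) (h.pos x t ht)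

lemma abs_soundSpeed_pdx_le (h : IsDampedFlow K γ a τ u) (hK : 0 < K) (hγ : 0 < γ) {m M x t : ℝ}
    (ht : 0 ≤ t) (hm : 0 < m) (hτ : m ≤ τ x t) (hM : |pdx τ x t| ≤ M) :
    |-((γ + 1) / (2 * τ x t)) * soundSpeed K γ (τ x t) * pdx τ x t| ≤
      (γ + 1) / (2 * m) * soundSpeed K γ m * M := by
  have hpos := h.pos x t ht
  have hc := soundSpeed_pos hK hγ hpos
  have hc' := soundSpeed_pos hK hγ hm
  rw [abs_mul, abs_mul, abs_neg, abs_of_pos hc, abs_of_pos (by positivity)]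
  have := soundSpeed_le (K := K) (by linarith : -1 < γ) hm hτ
  gcongr

lemma exists_characteristic (h : IsDampedFlow K γ a τ u) (hK : 0 < K) (hγ : 0 < γ) {m M : ℝ}
    (hm : 0 < m) (hτ : ∀ x, ∀ t ∈ Icc (0 : ℝ) 1, m ≤ τ x t)
    (hM : ∀ x, ∀ t ∈ Icc (0 : ℝ) 1, |pdx τ x t| ≤ M) (x₀ : ℝ) :
    ∃ X : ℝ → ℝ, X 0 = x₀ ∧ ContinuousOn X (Icc 0 1) ∧
      ∀ t ∈ Ioo (0 : ℝ) 1, HasDerivAt X (soundSpeed K γ (τ (X t) t)) t := by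
  have hc := soundSpeed_pos hK hγ hm
  have hMnn : 0 ≤ M := (abs_nonneg _).trans (hM 0 0 (by simp))
  set Λ : NNReal := ⟨(γ + 1) / (2 * m) * soundSpeed K γ m * M, by positivity⟩ with hΛ
  set c : NNReal := ⟨soundSpeed K γ m, hc.le⟩ with hcdef
  have hPL : IsPicardLindelof (fun t x => soundSpeed K γ (τ x t)) (tmin := 0) (tmax := 1)
      ⟨0, by simp⟩ x₀ c 0 c Λ := by
    refine ⟨fun t ht => ?_, fun x _ => ?_, fun t ht x _ => ?_, ?_⟩
    · refine LipschitzWith.lipschitzOnWith (LipschitzWith.of_dist_le_mul fun x y => ?_)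
      exact abs_sub_le_of_hasDerivAt (fun z => h.hasDerivAt_soundSpeed_pdx z ht.1)
        (fun z => h.abs_soundSpeed_pdx_le hK hγ ht.1 hm (hτ z t ht) (hM z t ht)) y x
    · exact (h.continuousOn_soundSpeed univ).comp (f := fun t => (x, t)) (by fun_prop)
        fun t ht => ⟨mem_univ _, ht⟩
    · rw [Real.norm_eq_abs, abs_of_pos (soundSpeed_pos hK hγ (h.pos x t ht.1))]
      exact soundSpeed_le (by linarith) hm (hτ x t ht)
    · simp
  obtain ⟨X, hX0, hX⟩ := hPL.exists_eq_forall_mem_Icc_hasDerivWithinAt₀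
  exact ⟨X, hX0, fun t ht => (hX t ht).continuousWithinAt,
    fun t ht => (hX t (Ioo_subset_Icc_self ht)).hasDerivAt (Icc_mem_nhds ht.1 ht.2)⟩

/-- Along a forward characteristic, the gradient `y = (u + φ)_x` satisfies
`y' = -((γ+1)/(4τ)) (y - ρ) y - a (y + ρ) / 2` with `ρ = (u - φ)_x`. -/
lemma hasDerivAt_gradient (h : IsDampedFlow K γ a τ u) (hK : 0 < K) (hγ : 1 < γ) {m M A : ℝ}
    (hm : 0 < m) (hτ : ∀ x, ∀ t ∈ Icc (0 : ℝ) 1, m ≤ τ x t)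
    (hMτ : ∀ x, ∀ t ∈ Icc (0 : ℝ) 1, |pdx τ x t| ≤ M)
    (hMu : ∀ x, ∀ t ∈ Icc (0 : ℝ) 1, |pdx u x t| ≤ M)
    (ka : ContinuousOn a (Icc 0 1)) (hA : ∀ t ∈ Icc (0 : ℝ) 1, |a t| ≤ A) {X : ℝ → ℝ}
    (kX : ContinuousOn X (Icc 0 1))
    (hX : ∀ t ∈ Ioo (0 : ℝ) 1, HasDerivAt X (soundSpeed K γ (τ (X t) t)) t) {t : ℝ}
    (ht : t ∈ Ioo (0 : ℝ) 1) :
    HasDerivAt (fun t => pdx u (X t) t - soundSpeed K γ (τ (X t) t) * pdx τ (X t) t)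
      (-(a t * pdx u (X t) t) -
        -((γ + 1) / (2 * τ (X t) t)) * soundSpeed K γ (τ (X t) t) * pdx τ (X t) t *
          (pdx u (X t) t - soundSpeed K γ (τ (X t) t) * pdx τ (X t) t)) t := by
  have hγ0 : 0 < γ := by linarith
  have hc := soundSpeed_pos hK hγ0 hm
  have hMnn : 0 ≤ M := (abs_nonneg _).trans (hMτ 0 0 (by simp))
  have hAnn : 0 ≤ A := (abs_nonneg _).trans (hA 0 (by simp))
  have n1 : 0 ≤ (γ + 1) / (2 * m) * soundSpeed K γ m * M := by positivity
  have n2 : 0 ≤ soundSpeed K γ m * M := by positivity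
  have n3 : 0 ≤ A * M := by positivity
  have kc := h.continuousOn_soundSpeed (T := 1) univ
  have kτx := (continuous_pdx h.contDiff_vol).continuousOn (s := univ ×ˢ Icc (0 : ℝ) 1)
  have kux := (continuous_pdx h.contDiff_vel).continuousOn (s := univ ×ˢ Icc (0 : ℝ) 1)
  have kτ := h.contDiff_vol.continuous.continuousOn (s := univ ×ˢ Icc (0 : ℝ) 1)
  have ku := h.contDiff_vel.continuous.continuousOn (s := univ ×ˢ Icc (0 : ℝ) 1)
  have ka' : ContinuousOn (fun p : ℝ × ℝ => a p.2) (univ ×ˢ Icc 0 1) :=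
    ka.comp continuousOn_snd fun p hp => hp.2
  refine hasDerivAt_transport
    (S := fun x t => u x t + riemannPot K γ (τ x t))
    (c := fun x t => soundSpeed K γ (τ x t))
    (f := fun x t => -(a t * u x t))
    (Sx := fun x t => pdx u x t - soundSpeed K γ (τ x t) * pdx τ x t)
    (cx := fun x t => -((γ + 1) / (2 * τ x t)) * soundSpeed K γ (τ x t) * pdx τ x t)
    (fx := fun x t => -(a t * pdx u x t))
    (St := fun x t => pdt u x t + -soundSpeed K γ (τ x t) * pdt τ x t)
    (L := (γ + 1) / (2 * m) * soundSpeed K γ m * M + (M + soundSpeed K γ m * M) + A * M)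
    ?_ ?_ ?_ ?_ ?_ ?_ ?_ ?_ ?_ kc ?_ ?_ ?_ ?_ kX hX ht
  · intro t ht Y v hY
    refine ((hasDerivAt_along h.contDiff_vel hY).add (hasDerivAt_riemannPot_comp hγ.ne'
      (hasDerivAt_along h.contDiff_vol hY) (h.pos _ _ ht.1.le))).congr_deriv ?_
    ring
  · intro x t ht
    refine ((hasDerivAt_pdx h.contDiff_vel x t).add (hasDerivAt_riemannPot_comp hγ.ne'
      (hasDerivAt_pdx h.contDiff_vol x t) (h.pos _ _ ht.1))).congr_deriv ?_
    ring
  · exact fun x t ht => h.hasDerivAt_soundSpeed_pdx x ht.1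
  · exact fun x t ht => ((hasDerivAt_pdx h.contDiff_vel x t).const_mul (a t)).neg
  · intro x t ht
    rw [h.mass x t ht.1.le, h.momentum x t ht.1.le]
    ring
  · intro x t ht
    have h1 := abs_sub (pdx u x t) (soundSpeed K γ (τ x t) * pdx τ x t)
    have h2 : |soundSpeed K γ (τ x t) * pdx τ x t| ≤ soundSpeed K γ m * M := by
      rw [abs_mul, abs_of_pos (soundSpeed_pos hK hγ0 (h.pos x t ht.1))]
      exact mul_le_mul (soundSpeed_le (by linarith) hm (hτ x t ht)) (hMτ x t ht) (abs_nonneg _)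
        hc.le
    linarith [hMu x t ht]
  · intro x t ht
    have := h.abs_soundSpeed_pdx_le hK hγ0 ht.1 hm (hτ x t ht) (hMτ x t ht)
    linarith
  · intro x t ht
    have : |a t * pdx u x t| ≤ A * M := by
      rw [abs_mul]
      exact mul_le_mul (hA t ht) (hMu x t ht) (abs_nonneg _) hAnn
    rw [abs_neg]
    linarith
  · exact ku.add (h.continuousOn_riemannPot hγ.ne' _)
  · exact (ka'.mul ku).neg
  · exact kux.sub (kc.mul kτx)
  · refine ContinuousOn.mul (ContinuousOn.mul (ContinuousOn.neg ?_) kc) kτx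
    refine continuousOn_const.div (continuousOn_const.mul kτ) fun p hp => ?_
    have := h.pos p.1 p.2 hp.2.1
    positivity
  · exact (ka'.mul kux).neg

/-- A sufficiently steep compression at time `0` is incompatible with bounded derivatives up to
time `1`. -/
lemma false_of_steep (h : IsDampedFlow K γ a τ u) (hK : 0 < K) (hγ : 3 < γ) {m M A N : ℝ}
    {a' : ℝ → ℝ} (hm : 0 < m) (hτ : ∀ x, ∀ t ∈ Icc (0 : ℝ) 1, m ≤ τ x t)
    (hMτ : ∀ x, ∀ t ∈ Icc (0 : ℝ) 1, |pdx τ x t| ≤ M)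
    (hMu : ∀ x, ∀ t ∈ Icc (0 : ℝ) 1, |pdx u x t| ≤ M)
    (ha : ∀ t ∈ Icc (0 : ℝ) 1, HasDerivAt a (a' t) t)
    (ha0 : ∀ t ∈ Icc (0 : ℝ) 1, 0 ≤ a t) (hA : ∀ t ∈ Icc (0 : ℝ) 1, a t ≤ A)
    (hA' : ∀ t ∈ Icc (0 : ℝ) 1, |a' t| ≤ A)
    (hN : 2 * A * (2 / (γ - 3) * m ^ (-(γ - 3) / 4)) +
      (4 * A + 12) * (4 * m ^ (-(γ - 3) / 4) / (γ + 1)) ≤ N) (x₀ : ℝ)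
    (hx₀ : τ x₀ 0 ^ (-(γ + 1) / 4) *
      (pdx u x₀ 0 - soundSpeed K γ (τ x₀ 0) * pdx τ x₀ 0) < -N) : False := by
  obtain ⟨X, hX0, kX, hX⟩ := h.exists_characteristic hK (by linarith) hm hτ hMτ x₀
  have hγ3 : 0 < γ - 3 := by linarith
  have hAnn : 0 ≤ A := (ha0 0 (by simp)).trans (hA 0 (by simp))
  have ka : ContinuousOn a (Icc 0 1) := fun t ht => (ha t ht).continuousAt.continuousWithinAt
  set H := m ^ (-(γ - 3) / 4) with hH
  have hH0 : 0 < H := rpow_pos_of_pos hm _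
  set G := 2 / (γ - 3) * H with hG
  have hG0 : 0 < G := by positivity
  set D := 4 * H / (γ + 1) with hD
  have hD0 : 0 < D := by positivity
  have hN0 : 0 < N := lt_of_lt_of_le (by positivity) hN
  set y : ℝ → ℝ := fun t => pdx u (X t) t - soundSpeed K γ (τ (X t) t) * pdx τ (X t) t with hy
  set θ : ℝ → ℝ := fun t => τ (X t) t with hθ
  have hθpos : ∀ t ∈ Icc (0 : ℝ) 1, 0 < θ t := fun t ht => h.pos _ t ht.1
  set η : ℝ → ℝ := fun t => θ t ^ (-(γ + 1) / 4) with hη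
  have hηpos : ∀ t ∈ Icc (0 : ℝ) 1, 0 < η t := fun t ht => rpow_pos_of_pos (hθpos t ht) _
  have hθη : ∀ t ∈ Icc (0 : ℝ) 1, θ t * η t ≤ H := by
    intro t ht
    have : θ t * η t = θ t ^ (-(γ - 3) / 4) := by
      rw [hη, ← Real.rpow_one_add' (hθpos t ht).le (by linarith)]
      congr 1; ring
    rw [this]
    exact Real.rpow_le_rpow_of_nonpos hm (hτ _ t ht) (by linarith)
  have hp : ContinuousOn (fun t => (X t, t)) (Icc 0 1) := kX.prodMk continuousOn_id
  have hmaps : MapsTo (fun t => (X t, t)) (Icc (0 : ℝ) 1) (univ ×ˢ Icc 0 1) := fun t ht =>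
    ⟨mem_univ _, ht⟩
  have kθ : ContinuousOn θ (Icc 0 1) := h.contDiff_vol.continuous.comp_continuousOn hp
  have kη : ContinuousOn η (Icc 0 1) := kθ.rpow_const fun t ht => Or.inl (hθpos t ht).ne'
  have ky : ContinuousOn y (Icc 0 1) :=
    ((continuous_pdx h.contDiff_vel).comp_continuousOn hp).sub
      (((h.continuousOn_soundSpeed univ).comp hp hmaps).mul
        ((continuous_pdx h.contDiff_vol).comp_continuousOn hp))
  set q : ℝ → ℝ := fun t => η t * y t - a t * (2 / (γ - 3) * (θ t * η t)) with hq
  have kq : ContinuousOn q (Icc 0 1) :=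
    (kη.mul ky).sub (ka.mul (continuousOn_const.mul (kθ.mul kη)))
  have dq : ∀ t ∈ Ioo (0 : ℝ) 1, HasDerivAt q
      (-((γ + 1) / (4 * (θ t * η t))) * (η t * y t) ^ 2 - a t / 2 * (η t * y t)
        - a' t * (2 / (γ - 3) * (θ t * η t))) t := by
    intro t ht
    have ht' := Ioo_subset_Icc_self ht
    have dy : HasDerivAt y _ t := h.hasDerivAt_gradient hK (by linarith) hm hτ hMτ hMu ka
      (fun t ht => by rw [abs_of_nonneg (ha0 t ht)]; exact hA t ht) kX hX ht
    have dθ : HasDerivAt θ _ t := hasDerivAt_along h.contDiff_vol (hX t ht)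
    rw [h.mass _ t ht.1.le] at dθ
    have dη := dθ.rpow_const (p := -(γ + 1) / 4) (Or.inl (hθpos t ht').ne')
    rw [Real.rpow_sub_one (hθpos t ht').ne'] at dη
    refine ((dη.mul dy).sub ((ha t ht').mul ((dθ.mul dη).const_mul (2 / (γ - 3))))).congr_deriv ?_
    have e1 : θ t ^ (-(γ + 1) / 4) = η t := rfl
    have e2 : τ (X t) t = θ t := rfl
    have e3 : (θ * fun s => θ s ^ (-(γ + 1) / 4)) t = θ t * η t := rfl
    rw [e3, e1, e2]
    have n1 := (hθpos t ht').ne'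
    have n2 := (hηpos t ht').ne'
    simp only [hy, e2]
    field_simp
    ring
  have hqle : ∀ t ∈ Icc (0 : ℝ) 1, q t ≤ η t * y t ∧ η t * y t ≤ q t + A * G := by
    intro t ht
    have h1 : 0 ≤ θ t * η t := (mul_pos (hθpos t ht) (hηpos t ht)).le
    have h2 : 0 ≤ 2 / (γ - 3) * (θ t * η t) := by positivity
    have h3 : 2 / (γ - 3) * (θ t * η t) ≤ G :=
      mul_le_mul_of_nonneg_left (hθη t ht) (by positivity)
    have h4 := mul_nonneg (ha0 t ht) h2
    have h5 := mul_le_mul (hA t ht) h3 h2 hAnn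
    simp only [hq]
    constructor <;> linarith
  refine false_of_riccati (β := (8 * D)⁻¹) hN0 ?_ kq dq ?_ ?_
  · rw [inv_mul_eq_div, le_div_iff₀ (by positivity)]
    have : 0 ≤ A * G := by positivity
    have : 0 ≤ A * D := by positivity
    nlinarith
  · intro t ht hqN
    have ht' := Ioo_subset_Icc_self ht
    obtain ⟨w1, w2⟩ := hqle t ht'
    set w := η t * y t with hw
    have hg0 : 0 < θ t * η t := mul_pos (hθpos t ht') (hηpos t ht')
    have hb : D⁻¹ ≤ (γ + 1) / (4 * (θ t * η t)) := by
      rw [hD, inv_div]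
      have := hθη t ht'
      gcongr
    have hAD : 0 ≤ A * D := by positivity
    have hAG : 0 ≤ A * G := by positivity
    have hAG2 : 2 * (A * G) ≤ -q t := by nlinarith
    have hw2 : w ≤ q t / 2 := by linarith
    have hq0 : q t < 0 := by linarith
    have t1 : D⁻¹ * (q t ^ 2 / 4) ≤ (γ + 1) / (4 * (θ t * η t)) * w ^ 2 := by
      refine mul_le_mul hb ?_ (by positivity) (by positivity)
      nlinarith
    have t2 : -(a t / 2 * w) ≤ A / 2 * -q t := by
      have := mul_le_mul (hA t ht') (neg_le_neg w1) (by linarith) hAnn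
      linarith
    have t3 : -(a' t * (2 / (γ - 3) * (θ t * η t))) ≤ A * G := by
      rw [← neg_mul]
      refine mul_le_mul ((neg_le_abs _).trans (hA' t ht')) ?_ (by positivity) hAnn
      exact mul_le_mul_of_nonneg_left (hθη t ht') (by positivity)
    have t4 : A / 2 * -q t + A * G ≤ D⁻¹ * (q t ^ 2 / 8) := by
      rw [inv_mul_eq_div, le_div_iff₀ hD0]
      have : (4 * A + 12) * D ≤ -q t := by linarith
      nlinarith
    have e : -(8 * D)⁻¹ * q t ^ 2 = -(D⁻¹ * (q t ^ 2 / 8)) := by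
      field_simp
    rw [e]
    linarith
  · have := (hqle 0 (by simp)).1
    simp only [hη, hy, hθ, hX0] at this
    exact this.trans_lt hx₀

lemma reflect (h : IsDampedFlow K γ a τ u) :
    IsDampedFlow K γ a (fun x t => τ (-x) t) (fun x t => -u (-x) t) := by
  have refl_smooth : ContDiff ℝ 1 fun p : ℝ × ℝ => (-p.1, p.2) := by fun_prop
  refine ⟨h.contDiff_vol.comp refl_smooth, (h.contDiff_vel.comp refl_smooth).neg,
    fun x t ht => h.pos (-x) t ht, fun x t ht => ?_, fun x t ht => ?_⟩
  · rw [pdx_neg_comp_neg]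
    exact h.mass (-x) t ht
  · have := h.momentum (-x) t ht
    rw [pdx_comp_neg]
    have e : pdt (fun x t => -u (-x) t) x t = -pdt u (-x) t := by
      simp [pdt]
    rw [e, this]
    ring

end IsDampedFlow

lemma exists_riemannPot_eq {K γ M₀ : ℝ} (hK : 0 < K) (hγ : 1 < γ) (hM₀ : 0 < M₀) :
    ∃ m > 0, riemannPot K γ m = M₀ := by
  have h1 : 0 < γ - 1 := by linarith
  have h2 : 0 < γ := by linarith
  have hκ : 0 < 2 * √(K * γ) / (γ - 1) := by positivity
  refine ⟨(M₀ / (2 * √(K * γ) / (γ - 1))) ^ (-2 / (γ - 1)), by positivity, ?_⟩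
  rw [riemannPot, ← Real.rpow_mul (by positivity),
    show -2 / (γ - 1) * (-(γ - 1) / 2) = 1 by field_simp, Real.rpow_one, mul_div_cancel₀ _ hκ.ne']

lemma riemannPot_rpow {K γ z : ℝ} (hγ : 1 < γ) (hz : 0 < z) (p : ℝ) :
    riemannPot K γ z ^ p =
      (2 * √(K * γ) / (γ - 1)) ^ p * z ^ (-(γ - 1) / 2 * p) := by
  have h1 : 0 < γ - 1 := by linarith
  rw [riemannPot, Real.mul_rpow (by positivity) (by positivity), Real.rpow_mul hz.le]

lemma exists_damping_bound (α lam : ℝ) : ∃ (A : ℝ) (a' : ℝ → ℝ), ∀ t ∈ Icc (0 : ℝ) 1,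
    HasDerivAt (fun t => α / (1 + t) ^ lam) (a' t) t ∧ α / (1 + t) ^ lam ≤ A ∧ |a' t| ≤ A := by
  have hpos : ∀ t ∈ Icc (0 : ℝ) 1, 0 < 1 + t := fun t ht => by linarith [ht.1]
  set a' : ℝ → ℝ := fun t => α * (-lam * (1 + t) ^ (-lam - 1)) with ha'
  have ka : ContinuousOn (fun t => α / (1 + t) ^ lam) (Icc (0 : ℝ) 1) :=
    continuousOn_const.div
      ((continuousOn_const.add continuousOn_id).rpow_const fun t ht => Or.inl (hpos t ht).ne')
      fun t ht => (rpow_pos_of_pos (hpos t ht) _).ne'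
  have ka' : ContinuousOn a' (Icc (0 : ℝ) 1) :=
    continuousOn_const.mul (continuousOn_const.mul
      ((continuousOn_const.add continuousOn_id).rpow_const fun t ht => Or.inl (hpos t ht).ne'))
  obtain ⟨A₁, hA₁⟩ := isCompact_Icc.exists_bound_of_continuousOn ka
  obtain ⟨A₂, hA₂⟩ := isCompact_Icc.exists_bound_of_continuousOn ka'
  refine ⟨max A₁ A₂, a', fun t ht => ⟨?_, ?_, ?_⟩⟩
  · have h1 : HasDerivAt (fun t : ℝ => 1 + t) 1 t := (hasDerivAt_id t).const_add 1
    have h2 := (h1.rpow_const (p := -lam) (Or.inl (hpos t ht).ne')).const_mul α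
    refine (h2.congr_of_eventuallyEq ?_).congr_deriv (by simp [ha'])
    filter_upwards [lt_mem_nhds (show -1 < t by linarith [ht.1])] with s hs
    rw [Real.rpow_neg (by linarith), div_eq_mul_inv]
  · exact (le_abs_self _).trans ((hA₁ t ht).trans (le_max_left _ _))
  · exact (hA₂ t ht).trans (le_max_right _ _)

/-- If the derivatives of a solution stay bounded up to time `1`, then the gradient of `u + φ`
cannot be too negative initially. -/
lemma exists_steepness_threshold {K γ α C₀ : ℝ} (lam : ℝ) (hK : 0 < K) (hγ : 3 < γ) (hα : 0 ≤ α)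
    (hC₀ : 0 < C₀) : ∃ K₂ > (0 : ℝ), ∀ (τ u : ℝ → ℝ → ℝ) (M x₀ : ℝ),
      IsDampedFlow K γ (fun t => α / (1 + t) ^ lam) τ u →
      (∀ x, |u x 0| ≤ C₀) → (∀ x, C₀⁻¹ < τ x 0) →
      (∀ x, ∀ t ∈ Icc (0 : ℝ) 1, |pdx τ x t| ≤ M) →
      (∀ x, ∀ t ∈ Icc (0 : ℝ) 1, |pdx u x t| ≤ M) →
      Phi K γ τ x₀ 0 ^ (-2 / (γ - 1)) - K₂ * Phi K γ τ x₀ 0 ^ (-(γ + 1) / (2 * (γ - 1))) ≤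
        pdx u x₀ 0 + pdx (Phi K γ τ) x₀ 0 := by
  have hγ1 : 1 < γ := by linarith
  have hγ1' : 0 < γ - 1 := by linarith
  have hγ3 : 0 < γ - 3 := by linarith
  have hγ0 : 0 < γ := by linarith
  have hC₀' : 0 < C₀⁻¹ := inv_pos.2 hC₀
  obtain ⟨A, a', hA⟩ := exists_damping_bound α lam
  obtain ⟨m, hm, hmM⟩ := exists_riemannPot_eq (M₀ := C₀ + riemannPot K γ C₀⁻¹) hK hγ1
    (add_pos hC₀ (riemannPot_pos hK hγ1 hC₀'))
  have ha0 : ∀ t ∈ Icc (0 : ℝ) 1, 0 ≤ α / (1 + t) ^ lam := fun t ht =>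
    div_nonneg hα (Real.rpow_nonneg (by linarith [ht.1]) _)
  have hA0 : 0 ≤ A := (ha0 0 (by simp)).trans (hA 0 (by simp)).2.1
  set κ := 2 * √(K * γ) / (γ - 1) with hκ
  have hκ0 : 0 < κ := by positivity
  set H := m ^ (-(γ - 3) / 4) with hH
  have hH0 : 0 < H := rpow_pos_of_pos hm _
  set N := 2 * A * (2 / (γ - 3) * H) + (4 * A + 12) * (4 * H / (γ + 1)) with hN
  have hN0 : 0 < N := by positivity
  set κ₁ := κ ^ (-2 / (γ - 1)) with hκ₁
  have hκ₁0 : 0 < κ₁ := rpow_pos_of_pos hκ0 _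
  set κ₂ := κ ^ (-(γ + 1) / (2 * (γ - 1))) with hκ₂
  have hκ₂0 : 0 < κ₂ := rpow_pos_of_pos hκ0 _
  refine ⟨(N + κ₁ * H) / κ₂, by positivity, fun τ u M x₀ h hu hτ hMτ hMu => ?_⟩
  have h0 : ∀ x, |u x 0| + riemannPot K γ (τ x 0) ≤ riemannPot K γ m := fun x => by
    rw [hmM]
    exact add_le_add (hu x) ((riemannPot_le_iff hK hγ1 (h.pos x 0 le_rfl) hC₀').2 (hτ x).le)
  have hτm : ∀ x, ∀ t ∈ Icc (0 : ℝ) 1, m ≤ τ x t := fun x t ht =>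
    h.le_vol hK hγ1 ha0 hm hMu h0 x ht
  by_contra! hlt
  refine h.false_of_steep hK hγ hm hτm hMτ hMu (fun t ht => (hA t ht).1) ha0
    (fun t ht => (hA t ht).2.1) (fun t ht => (hA t ht).2.2) le_rfl x₀ ?_
  have hpos := h.pos x₀ 0 le_rfl
  set z := τ x₀ 0 with hz
  have hzη : 0 < z ^ (-(γ + 1) / 4) := rpow_pos_of_pos hpos _
  have hPhi : Phi K γ τ x₀ 0 = riemannPot K γ z := rfl
  rw [pdx_Phi hγ1.ne' h.contDiff_vol hpos, hPhi, riemannPot_rpow hγ1 hpos,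
    riemannPot_rpow hγ1 hpos, ← hκ, ← hκ₁, ← hκ₂,
    show -(γ - 1) / 2 * (-2 / (γ - 1)) = 1 by field_simp,
    show -(γ - 1) / 2 * (-(γ + 1) / (2 * (γ - 1))) = -(-(γ + 1) / 4) by field_simp; ring,
    Real.rpow_neg hpos.le, Real.rpow_one, ← hz, ← mul_assoc, div_mul_cancel₀ _ hκ₂0.ne'] at hlt
  have hle : z ^ (-(γ + 1) / 4) * z ≤ H := by
    rw [← Real.rpow_add_one hpos.ne', show -(γ + 1) / 4 + 1 = -(γ - 3) / 4 by ring]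
    exact Real.rpow_le_rpow_of_nonpos hm (hτm x₀ 0 (by simp)) (by linarith)
  have h1 := mul_lt_mul_of_pos_left hlt hzη
  have h2 : z ^ (-(γ + 1) / 4) * (κ₁ * z - (N + κ₁ * H) * (z ^ (-(γ + 1) / 4))⁻¹) =
      κ₁ * (z ^ (-(γ + 1) / 4) * z) - (N + κ₁ * H) := by
    field_simp
  have h3 := mul_le_mul_of_nonneg_left hle hκ₁0.le
  rw [h2] at h1
  rw [sub_eq_add_neg, ← neg_mul]
  linarith

theorem stmt1 (K γ α lam C₀ : ℝ) (hK : 0 < K) (hγ : 3 < γ) (hα : 0 ≤ α)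
    (hlam : lam < min 1 (α * (γ - 1) / (γ - 3)) ∨ max 1 (α * (γ - 1) / (γ - 3)) < lam)
    (hC₀ : 0 < C₀) :
    ∃ K₁ > (0 : ℝ), ∃ K₂ > (0 : ℝ),
      ∀ (τ₀ u₀ : ℝ → ℝ), ContDiff ℝ 1 τ₀ → ContDiff ℝ 1 u₀ →
        (∀ x, |u₀ x| ≤ C₀) → (∀ x, C₀⁻¹ < τ₀ x) →
      ∀ (τ u : ℝ → ℝ → ℝ), IsSol K γ α lam τ u →
        (∀ x, τ x 0 = τ₀ x ∧ u x 0 = u₀ x) →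
      ∀ x₀ : ℝ,
        (pdx u x₀ 0 + pdx (Phi K γ τ) x₀ 0 <
            K₁ * Phi K γ τ x₀ 0 ^ (-2 / (γ - 1)) -
              K₂ * Phi K γ τ x₀ 0 ^ (-(γ + 1) / (2 * (γ - 1))) ∨
         pdx u x₀ 0 - pdx (Phi K γ τ) x₀ 0 <
            K₁ * Phi K γ τ x₀ 0 ^ (-2 / (γ - 1)) -
              K₂ * Phi K γ τ x₀ 0 ^ (-(γ + 1) / (2 * (γ - 1)))) →
        BlowsUp τ u := by
  obtain ⟨K₂, hK₂, main⟩ := exists_steepness_threshold lam hK hγ hα hC₀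
  refine ⟨1, one_pos, K₂, hK₂, fun τ₀ u₀ _ _ hu₀ hτ₀ τ u hsol hinit x₀ hx₀ => ⟨1, one_pos, ?_⟩⟩
  rintro ⟨M, hM⟩
  have hM' : ∀ x, ∀ t ∈ Icc (0 : ℝ) 1, |pdx τ x t| + |pdx u x t| ≤ M := fun x t ht =>
    hM ⟨x, t, ht.1, ht.2, rfl⟩
  have hMτ : ∀ x, ∀ t ∈ Icc (0 : ℝ) 1, |pdx τ x t| ≤ M := fun x t ht => by
    linarith [hM' x t ht, abs_nonneg (pdx u x t)]
  have hMu : ∀ x, ∀ t ∈ Icc (0 : ℝ) 1, |pdx u x t| ≤ M := fun x t ht => by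
    linarith [hM' x t ht, abs_nonneg (pdx τ x t)]
  have hu : ∀ x, |u x 0| ≤ C₀ := fun x => by rw [(hinit x).2]; exact hu₀ x
  have hτ : ∀ x, C₀⁻¹ < τ x 0 := fun x => by rw [(hinit x).1]; exact hτ₀ x
  have hflow := hsol.isDampedFlow hK.le (by linarith)
  simp only [one_mul] at hx₀
  rcases hx₀ with hx₀ | hx₀
  · exact absurd hx₀ (not_lt.2 (main τ u M x₀ hflow hu hτ hMτ hMu))
  · have key := main (fun x t => τ (-x) t) (fun x t => -u (-x) t) M (-x₀) hflow.reflect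
      (fun x => by rw [abs_neg]; exact hu (-x)) (fun x => hτ (-x))
      (fun x t ht => by rw [pdx_comp_neg, abs_neg]; exact hMτ (-x) t ht)
      (fun x t ht => by rw [pdx_neg_comp_neg]; exact hMu (-x) t ht)
    have e1 : pdx (Phi K γ fun x t => τ (-x) t) (-x₀) 0 = -pdx (Phi K γ τ) x₀ 0 := by
      have := pdx_comp_neg (Phi K γ τ) (-x₀) 0
      rwa [neg_neg] at this
    have e2 : Phi K γ (fun x t => τ (-x) t) (-x₀) 0 = Phi K γ τ x₀ 0 := by
      simp only [Phi, neg_neg]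
    rw [pdx_neg_comp_neg, e1, e2, neg_neg, ← sub_eq_add_neg] at key
    exact absurd hx₀ (not_lt.2 key)
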